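/- arXiv:2412.15999 — 2 statements merged into one kernel-verified Lean document; each statement's English description precedes it below -/
import Mathlib

section
/- Let T ≥ 0 and let ρ be a Borel probability measure on [0,∞) with ρ({0}) = 0. Suppose F₁, F₂, K₁, K₂ are bounded Borel functions on [0,T] with K₁ ≤ F₁ + ½(K₁²)*ρ and K₂ ≥ F₂ + ½(K₂²)*ρ pointwise on [0,T]. If F₁ ≤ F₂ and K₁ + K₂ ≥ 0 pointwise on [0,T], then K₁ ≤ K₂ pointwise on [0,T]. -/
open MeasureTheory

/-- The convolution of a function with a measure:
`(g * ρ)(t) = ∫_{[0,t]} g(t-s) ρ(ds)`. -/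
noncomputable def mconv (g : ℝ → ℝ) (ρ : Measure ℝ) (t : ℝ) : ℝ :=
  ∫ s in Set.Icc 0 t, g (t - s) ∂ρ

open Filter Topology

/-- The Laplace transform of a finite measure without an atom at `0` vanishes at infinity. -/
theorem tendsto_laplace_atTop_zero (ρ : Measure ℝ) [IsFiniteMeasure ρ] (hρ0 : ρ {0} = 0) :
    Tendsto (fun n : ℕ => ∫ s in Set.Ici 0, Real.exp (-(n * s)) ∂ρ) atTop (𝓝 0) := by
  have hpos : ∀ᵐ s ∂(ρ.restrict (Set.Ici 0)), 0 < s := by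
    have hne : ∀ᵐ s ∂(ρ.restrict (Set.Ici 0)), s ≠ 0 :=
      ae_restrict_of_ae (by simpa [ae_iff] using hρ0)
    filter_upwards [hne, ae_restrict_mem measurableSet_Ici] with s hs hs'
    exact lt_of_le_of_ne hs' hs.symm
  have h := tendsto_integral_of_dominated_convergence (μ := ρ.restrict (Set.Ici 0))
    (F := fun (n : ℕ) (s : ℝ) => Real.exp (-(n * s))) (f := fun _ => 0) (fun _ => 1)
    (fun n => by fun_prop) (integrable_const _) ?_ ?_
  · simpa using h
  · intro n
    filter_upwards [hpos] with s hs
    rw [Real.norm_eq_abs, Real.abs_exp, Real.exp_le_one_iff]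
    have : (0 : ℝ) ≤ n * s := by positivity
    linarith
  · filter_upwards [hpos] with s hs
    exact Real.tendsto_exp_neg_atTop_nhds_zero.comp
      (tendsto_natCast_atTop_atTop.atTop_mul_const hs)

/-- Bounded measurable functions can be convolved with a finite measure. -/
theorem integrableOn_comp_sub_of_bounded (ρ : Measure ℝ) [IsFiniteMeasure ρ] {g : ℝ → ℝ}
    (hg : Measurable g) {T t M : ℝ} (ht : t ∈ Set.Icc 0 T)
    (hM : ∀ u ∈ Set.Icc 0 T, |g u| ≤ M) :
    IntegrableOn (fun s => g (t - s)) (Set.Icc 0 t) ρ := by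
  refine Integrable.of_bound
    (hg.comp (measurable_const.sub measurable_id)).aestronglyMeasurable M ?_
  filter_upwards [ae_restrict_mem measurableSet_Icc] with s hs
  exact hM _ ⟨by linarith [hs.2], by linarith [hs.1, ht.2]⟩

/-- Comparison principle for the convolutional Riccati inequality:
if `K₁ ≤ F₁ + ½(K₁²)*ρ`, `K₂ ≥ F₂ + ½(K₂²)*ρ`, `F₁ ≤ F₂` and `K₁ + K₂ ≥ 0`
on `[0,T]`, then `K₁ ≤ K₂` on `[0,T]`. -/
theorem stmt_7 (T : ℝ) (hT : 0 ≤ T)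
    (ρ : Measure ℝ) [IsProbabilityMeasure ρ]
    (hρ0 : ρ {0} = 0) (hρpos : ρ (Set.Iio 0) = 0)
    (F₁ F₂ K₁ K₂ : ℝ → ℝ)
    (hF₁ : Measurable F₁) (hF₂ : Measurable F₂)
    (hK₁ : Measurable K₁) (hK₂ : Measurable K₂)
    (hF₁b : ∃ M : ℝ, ∀ t ∈ Set.Icc 0 T, |F₁ t| ≤ M)
    (hF₂b : ∃ M : ℝ, ∀ t ∈ Set.Icc 0 T, |F₂ t| ≤ M)
    (hK₁b : ∃ M : ℝ, ∀ t ∈ Set.Icc 0 T, |K₁ t| ≤ M)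
    (hK₂b : ∃ M : ℝ, ∀ t ∈ Set.Icc 0 T, |K₂ t| ≤ M)
    (hsub : ∀ t ∈ Set.Icc 0 T, K₁ t ≤ F₁ t + 2⁻¹ * mconv (fun u => (K₁ u) ^ 2) ρ t)
    (hsup : ∀ t ∈ Set.Icc 0 T, F₂ t + 2⁻¹ * mconv (fun u => (K₂ u) ^ 2) ρ t ≤ K₂ t)
    (hF : ∀ t ∈ Set.Icc 0 T, F₁ t ≤ F₂ t)
    (hKsum : ∀ t ∈ Set.Icc 0 T, 0 ≤ K₁ t + K₂ t) :
    ∀ t ∈ Set.Icc 0 T, K₁ t ≤ K₂ t := by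
  obtain ⟨M₁, hM₁⟩ := hK₁b
  obtain ⟨M₂, hM₂⟩ := hK₂b
  set C := M₁ + M₂ with hC
  have hC0 : 0 ≤ C := by
    have h0 : (0 : ℝ) ∈ Set.Icc 0 T := ⟨le_rfl, hT⟩
    linarith [abs_nonneg (K₁ 0), abs_nonneg (K₂ 0), hM₁ 0 h0, hM₂ 0 h0]
  have hsq : ∀ (K : ℝ → ℝ) (M : ℝ), (∀ u ∈ Set.Icc 0 T, |K u| ≤ M) →
      ∀ u ∈ Set.Icc 0 T, |K u ^ 2| ≤ M ^ 2 := by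
    intro K M h u hu
    rw [abs_pow]
    exact pow_le_pow_left₀ (abs_nonneg _) (h u hu) 2
  obtain ⟨n, hn⟩ : ∃ n : ℕ, C * ∫ s in Set.Ici 0, Real.exp (-(n * s)) ∂ρ < 1 := by
    have h := (tendsto_laplace_atTop_zero ρ hρ0).const_mul C
    rw [mul_zero] at h
    exact (h.eventually (gt_mem_nhds one_pos)).exists
  have hexp : IntegrableOn (fun s : ℝ => Real.exp (-(n * s))) (Set.Ici 0) ρ := by
    refine Integrable.of_bound (by fun_prop) 1 ?_
    filter_upwards [ae_restrict_mem measurableSet_Ici] with s hs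
    rw [Real.norm_eq_abs, Real.abs_exp, Real.exp_le_one_iff]
    have : (0 : ℝ) ≤ n * s := mul_nonneg n.cast_nonneg hs
    linarith
  have contract : ∀ A : ℝ, 0 ≤ A → (∀ t ∈ Set.Icc 0 T, K₁ t - K₂ t ≤ A * Real.exp (n * t)) →
      ∀ t ∈ Set.Icc 0 T, K₁ t - K₂ t ≤ A / 2 * Real.exp (n * t) := by
    intro A hA h t ht
    have hi₁ := integrableOn_comp_sub_of_bounded ρ (hK₁.pow_const 2) ht (hsq _ _ hM₁)
    have hi₂ := integrableOn_comp_sub_of_bounded ρ (hK₂.pow_const 2) ht (hsq _ _ hM₂)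
    have hexp_t := hexp.mono_set (Set.Icc_subset_Ici_self : Set.Icc 0 t ⊆ Set.Ici 0)
    have hdiff : mconv (fun u => K₁ u ^ 2) ρ t - mconv (fun u => K₂ u ^ 2) ρ t ≤
        C * A * Real.exp (n * t) * ∫ s in Set.Icc 0 t, Real.exp (-(n * s)) ∂ρ := by
      unfold mconv
      rw [← integral_sub hi₁ hi₂, ← integral_const_mul]
      refine setIntegral_mono_on (hi₁.sub hi₂) (hexp_t.const_mul _) measurableSet_Icc ?_
      intro s hs
      have hu : t - s ∈ Set.Icc 0 T := ⟨by linarith [hs.2], by linarith [hs.1, ht.2]⟩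
      have hS : K₁ (t - s) + K₂ (t - s) ≤ C :=
        add_le_add ((le_abs_self _).trans (hM₁ _ hu)) ((le_abs_self _).trans (hM₂ _ hu))
      calc K₁ (t - s) ^ 2 - K₂ (t - s) ^ 2
          = (K₁ (t - s) + K₂ (t - s)) * (K₁ (t - s) - K₂ (t - s)) := by ring
        _ ≤ (K₁ (t - s) + K₂ (t - s)) * (A * Real.exp (n * (t - s))) :=
            mul_le_mul_of_nonneg_left (h _ hu) (hKsum _ hu)
        _ ≤ C * (A * Real.exp (n * (t - s))) :=
            mul_le_mul_of_nonneg_right hS (by positivity)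
        _ = C * A * Real.exp (n * t) * Real.exp (-(n * s)) := by
            rw [mul_sub, sub_eq_add_neg, Real.exp_add]; ring
    have hmono : ∫ s in Set.Icc 0 t, Real.exp (-(n * s)) ∂ρ ≤
        ∫ s in Set.Ici 0, Real.exp (-(n * s)) ∂ρ :=
      setIntegral_mono_set hexp (ae_of_all _ fun s => (Real.exp_pos _).le)
        Set.Icc_subset_Ici_self.eventuallyLE
    have hle : C * A * Real.exp (n * t) * ∫ s in Set.Icc 0 t, Real.exp (-(n * s)) ∂ρ ≤
        A * Real.exp (n * t) :=
      calc C * A * Real.exp (n * t) * ∫ s in Set.Icc 0 t, Real.exp (-(n * s)) ∂ρ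
          = A * Real.exp (n * t) * (C * ∫ s in Set.Icc 0 t, Real.exp (-(n * s)) ∂ρ) := by ring
        _ ≤ A * Real.exp (n * t) * 1 :=
            mul_le_mul_of_nonneg_left
              ((mul_le_mul_of_nonneg_left hmono hC0).trans hn.le) (by positivity)
        _ = A * Real.exp (n * t) := mul_one _
    linarith [hsub t ht, hsup t ht, hF t ht]
  have iterate : ∀ k : ℕ, ∀ t ∈ Set.Icc 0 T,
      K₁ t - K₂ t ≤ C * (1 / 2) ^ k * Real.exp (n * t) := by
    intro k
    induction k with
    | zero =>
      intro t ht
      have h1 : K₁ t - K₂ t ≤ C := by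
        linarith [le_abs_self (K₁ t), neg_abs_le (K₂ t), hM₁ t ht, hM₂ t ht]
      have h2 : (1 : ℝ) ≤ Real.exp (n * t) :=
        Real.one_le_exp (mul_nonneg n.cast_nonneg ht.1)
      rw [pow_zero, mul_one]
      exact h1.trans (le_mul_of_one_le_right hC0 h2)
    | succ k ih =>
      intro t ht
      refine (contract _ (by positivity) ih t ht).trans_eq ?_
      rw [pow_succ]; ring
  intro t ht
  have hlim : Tendsto (fun k : ℕ => C * (1 / 2 : ℝ) ^ k * Real.exp (n * t)) atTop (𝓝 0) := by
    simpa using ((tendsto_pow_atTop_nhds_zero_of_lt_one (r := (1 / 2 : ℝ))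
      (by norm_num) (by norm_num)).const_mul C).mul_const (Real.exp (n * t))
  exact sub_nonpos.1 (ge_of_tendsto' hlim fun k => iterate k t ht)
end

section
/- Let T ≥ 0 and let ρ be a Borel probability measure on [0,∞) with ρ({0}) = 0. Suppose B, F are bounded Borel functions on [0,T] with ‖B‖_∞ < 1 and ‖F‖_∞ ≤ ½(1 − ‖B‖_∞)², and let (K_n[B,F])_{n≥0} be the unique solution of the triangular system K₀ = B; K₁ = F + (K₀K₁)*ρ; K_n = (½ Σ_{i=0}^{n} K_i K_{n−i})*ρ for n ≥ 2. Then Σ_{n≥0} ‖K_n[B,F]‖_∞ < ∞, and the sum K := Σ_{n≥0} K_n[B,F] satisfies K = F + ½(K²)*ρ + B − ½(B²)*ρ on [0,T]. -/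
open MeasureTheory

/-- The supremum norm of a function over `[0,T]`. -/
noncomputable def supNorm (g : ℝ → ℝ) (T : ℝ) : ℝ :=
  sSup ((fun t => |g t|) '' Set.Icc 0 T)

/-- `K : ℕ → ℝ → ℝ` is a bounded Borel solution on `[0,T]` of the infinite
triangular system `K₀ = B`, `K₁ = F + (K₀K₁)*ρ`,
`K_n = (½ Σ_{i=0}^{n} K_i K_{n-i})*ρ` for `n ≥ 2`. -/
def SolvesSystem (T : ℝ) (ρ : Measure ℝ) (B F : ℝ → ℝ) (K : ℕ → ℝ → ℝ) : Prop :=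
  (∀ n, Measurable (K n)) ∧
  (∀ n, ∃ M : ℝ, ∀ t ∈ Set.Icc 0 T, |K n t| ≤ M) ∧
  (∀ t ∈ Set.Icc 0 T, K 0 t = B t) ∧
  (∀ t ∈ Set.Icc 0 T, K 1 t = F t + mconv (fun u => K 0 u * K 1 u) ρ t) ∧
  (∀ n, 2 ≤ n → ∀ t ∈ Set.Icc 0 T,
    K n t = mconv (fun u => 2⁻¹ * ∑ i ∈ Finset.range (n + 1), K i u * K (n - i) u) ρ t)

lemma abs_le_supNorm {g : ℝ → ℝ} {T t : ℝ} (hg : ∃ M : ℝ, ∀ t ∈ Set.Icc 0 T, |g t| ≤ M)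
    (ht : t ∈ Set.Icc 0 T) : |g t| ≤ supNorm g T := by
  obtain ⟨M, hM⟩ := hg
  refine le_csSup ⟨M, ?_⟩ ⟨t, ht, rfl⟩
  rintro _ ⟨s, hs, rfl⟩
  exact hM s hs

lemma supNorm_le {g : ℝ → ℝ} {T C : ℝ} (hT : 0 ≤ T) (hg : ∀ t ∈ Set.Icc 0 T, |g t| ≤ C) :
    supNorm g T ≤ C := by
  refine csSup_le ⟨_, 0, ⟨le_rfl, hT⟩, rfl⟩ ?_
  rintro _ ⟨s, hs, rfl⟩
  exact hg s hs

lemma supNorm_nonneg (g : ℝ → ℝ) (T : ℝ) : 0 ≤ supNorm g T := by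
  refine Real.sSup_nonneg ?_
  rintro _ ⟨s, -, rfl⟩
  exact abs_nonneg _

lemma sub_mem_Icc_of_mem {T t s : ℝ} (ht : t ∈ Set.Icc 0 T) (hs : s ∈ Set.Icc 0 t) :
    t - s ∈ Set.Icc 0 T :=
  ⟨by linarith [hs.2], by linarith [hs.1, ht.2]⟩

lemma mconv_congr {g h : ℝ → ℝ} {T t : ℝ} (ρ : Measure ℝ) (hgh : ∀ u ∈ Set.Icc 0 T, g u = h u)
    (ht : t ∈ Set.Icc 0 T) : mconv g ρ t = mconv h ρ t :=
  setIntegral_congr_fun measurableSet_Icc fun _ hs => hgh _ (sub_mem_Icc_of_mem ht hs)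

lemma mconv_const_mul (c : ℝ) (g : ℝ → ℝ) (ρ : Measure ℝ) (t : ℝ) :
    mconv (fun u => c * g u) ρ t = c * mconv g ρ t :=
  integral_const_mul _ _

lemma abs_mconv_le {g : ℝ → ℝ} {T t C : ℝ} (ρ : Measure ℝ) [IsProbabilityMeasure ρ] (hC : 0 ≤ C)
    (hg : ∀ u ∈ Set.Icc 0 T, |g u| ≤ C) (ht : t ∈ Set.Icc 0 T) : |mconv g ρ t| ≤ C := by
  refine (norm_setIntegral_le_of_norm_le_const (f := fun s => g (t - s)) (C := C)
    (measure_lt_top ρ _) fun s hs => hg _ (sub_mem_Icc_of_mem ht hs)).trans ?_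
  exact mul_le_of_le_one_right hC measureReal_le_one

lemma hasSum_mconv {c : ℕ → ℝ → ℝ} {k : ℝ → ℝ} {A : ℕ → ℝ} {T t : ℝ} (ρ : Measure ℝ)
    [IsFiniteMeasure ρ] (hc : ∀ n, Measurable (c n))
    (hcA : ∀ n, ∀ u ∈ Set.Icc 0 T, |c n u| ≤ A n) (hA : Summable A)
    (hk : ∀ u ∈ Set.Icc 0 T, HasSum (fun n => c n u) (k u)) (ht : t ∈ Set.Icc 0 T) :
    HasSum (fun n => mconv (c n) ρ t) (mconv k ρ t) := by
  refine hasSum_integral_of_dominated_convergence (fun n _ => A n)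
    (fun n => ((hc n).comp (measurable_const.sub measurable_id)).aestronglyMeasurable)
    (fun n => ?_) (.of_forall fun _ => hA) (integrable_const _) ?_
  · filter_upwards [ae_restrict_mem measurableSet_Icc] with s hs
    exact hcA n _ (sub_mem_Icc_of_mem ht hs)
  · filter_upwards [ae_restrict_mem measurableSet_Icc] with s hs
    exact hk _ (sub_mem_Icc_of_mem ht hs)

lemma sum_range_cauchyProduct_le_sq {x : ℕ → ℝ} (hx : ∀ n, 0 ≤ x n) (N : ℕ) :
    ∑ m ∈ Finset.range N, ∑ i ∈ Finset.range (m + 1), x i * x (m - i) ≤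
      (∑ i ∈ Finset.range N, x i) ^ 2 := by
  rw [Finset.sum_range_diag_flip N fun i j => x i * x j, sq, Finset.sum_mul_sum]
  refine Finset.sum_le_sum fun m _ => ?_
  exact Finset.sum_le_sum_of_subset_of_nonneg (Finset.range_mono (Nat.sub_le _ _))
    fun _ _ _ => mul_nonneg (hx _) (hx _)

/-- A majorant estimate for quadratic recursions: the tail sums stay below `1 - a 0`. -/
lemma summable_of_quadratic_recursion {a : ℕ → ℝ} {f : ℝ} (ha : ∀ n, 0 ≤ a n) (ha0 : a 0 < 1)
    (hf : f ≤ 2⁻¹ * (1 - a 0) ^ 2) (ha1 : a 1 ≤ f + a 0 * a 1)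
    (han : ∀ n, 2 ≤ n → a n ≤ 2⁻¹ * ∑ i ∈ Finset.range (n + 1), a i * a (n - i)) :
    Summable a := by
  have hstep (m : ℕ) : (1 - a 0) * a (m + 2) ≤
      2⁻¹ * ∑ i ∈ Finset.range (m + 1), a (i + 1) * a (m - i + 1) := by
    have h := han (m + 2) (by omega)
    rw [Finset.sum_range_succ, Finset.sum_range_succ'] at h
    have hsum : ∑ i ∈ Finset.range (m + 1), a (i + 1) * a (m + 2 - (i + 1)) =
        ∑ i ∈ Finset.range (m + 1), a (i + 1) * a (m - i + 1) := by
      refine Finset.sum_congr rfl fun i hi => ?_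
      rw [Finset.mem_range] at hi
      congr 2
      omega
    rw [hsum] at h
    simp only [Nat.sub_zero, Nat.sub_self] at h
    linarith
  have hbound (N : ℕ) : ∑ n ∈ Finset.range N, a (n + 1) ≤ 1 - a 0 := by
    induction N with
    | zero => simpa using ha0.le
    | succ N ih =>
      have hle := Finset.sum_le_sum fun m (_ : m ∈ Finset.range N) => hstep m
      rw [← Finset.mul_sum, ← Finset.mul_sum] at hle
      have hsq := sum_range_cauchyProduct_le_sq (fun n => ha (n + 1)) N
      have hpow : (∑ n ∈ Finset.range N, a (n + 1)) ^ 2 ≤ (1 - a 0) ^ 2 :=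
        pow_le_pow_left₀ (Finset.sum_nonneg fun n _ => ha (n + 1)) ih 2
      rw [Finset.sum_range_succ']
      refine le_of_mul_le_mul_left ?_ (sub_pos.2 ha0)
      simp only [zero_add]
      nlinarith
  exact (summable_nat_add_iff 1).1 (summable_of_sum_range_le (fun n => ha (n + 1)) hbound)

/-- If `‖B‖_∞ < 1` and `‖F‖_∞ ≤ ½(1−‖B‖_∞)²`, then the solution
`(K_n)` of the triangular system satisfies `Σ_n ‖K_n‖_∞ < ∞`, and its sum `K`
satisfies `K = F + ½(K²)*ρ + B − ½(B²)*ρ` on `[0,T]`. -/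
theorem stmt_13 (T : ℝ) (hT : 0 ≤ T)
    (ρ : Measure ℝ) [IsProbabilityMeasure ρ]
    (hρ0 : ρ {0} = 0) (hρpos : ρ (Set.Iio 0) = 0)
    (B F : ℝ → ℝ) (hBmeas : Measurable B) (hFmeas : Measurable F)
    (hBbdd : ∃ M : ℝ, ∀ t ∈ Set.Icc 0 T, |B t| ≤ M)
    (hFbdd : ∃ M : ℝ, ∀ t ∈ Set.Icc 0 T, |F t| ≤ M)
    (hB : supNorm B T < 1)
    (hF : supNorm F T ≤ 2⁻¹ * (1 - supNorm B T) ^ 2)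
    (K : ℕ → ℝ → ℝ) (hK : SolvesSystem T ρ B F K) :
    Summable (fun n => supNorm (K n) T) ∧
    ∀ t ∈ Set.Icc 0 T,
      (∑' n : ℕ, K n t) =
        F t + 2⁻¹ * mconv (fun u => (∑' n : ℕ, K n u) ^ 2) ρ t +
          B t - 2⁻¹ * mconv (fun u => (B u) ^ 2) ρ t := by
  obtain ⟨hKm, hKb, hK0, hK1, hKn⟩ := hK
  have hle (n : ℕ) : ∀ u ∈ Set.Icc 0 T, |K n u| ≤ supNorm (K n) T :=
    fun u hu => abs_le_supNorm (hKb n) hu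
  have hnn (n : ℕ) : 0 ≤ supNorm (K n) T := supNorm_nonneg _ _
  have h0 : supNorm (K 0) T = supNorm B T :=
    congrArg sSup (Set.image_congr fun t ht => by simp only [hK0 t ht])
  set c : ℕ → ℝ → ℝ := fun n u => ∑ i ∈ Finset.range (n + 1), K i u * K (n - i) u with hc
  set A : ℕ → ℝ := fun n =>
    ∑ i ∈ Finset.range (n + 1), supNorm (K i) T * supNorm (K (n - i)) T with hA
  have hA0 (n : ℕ) : 0 ≤ A n := Finset.sum_nonneg fun i _ => mul_nonneg (hnn _) (hnn _)
  have hcA (n : ℕ) : ∀ u ∈ Set.Icc 0 T, |c n u| ≤ A n := fun u hu =>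
    (Finset.abs_sum_le_sum_abs _ _).trans <| Finset.sum_le_sum fun i _ => by
      rw [abs_mul]
      exact mul_le_mul (hle _ u hu) (hle _ u hu) (abs_nonneg _) (hnn _)
  have hsum : Summable fun n => supNorm (K n) T := by
    refine summable_of_quadratic_recursion hnn (h0 ▸ hB) (h0 ▸ hF) ?_ fun n hn => ?_
    · refine supNorm_le hT fun t ht => ?_
      rw [hK1 t ht]
      refine (abs_add_le _ _).trans (add_le_add (abs_le_supNorm hFbdd ht) ?_)
      refine abs_mconv_le ρ (mul_nonneg (hnn _) (hnn _)) (fun u hu => ?_) ht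
      rw [abs_mul]
      exact mul_le_mul (hle _ u hu) (hle _ u hu) (abs_nonneg _) (hnn _)
    · refine supNorm_le hT fun t ht => ?_
      rw [hKn n hn t ht]
      refine abs_mconv_le ρ (mul_nonneg (by norm_num) (hA0 n)) (fun u hu => ?_) ht
      rw [abs_mul, abs_of_pos (by norm_num : (0 : ℝ) < 2⁻¹)]
      exact mul_le_mul_of_nonneg_left (hcA n u hu) (by norm_num)
  refine ⟨hsum, fun t ht => ?_⟩
  have hAsum : Summable A := by
    have hnorm : Summable fun n => ‖supNorm (K n) T‖ := hsum.norm
    exact (summable_norm_sum_mul_range_of_summable_norm hnorm hnorm).of_norm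
  have hsquare : ∀ u ∈ Set.Icc 0 T, HasSum (fun n => c n u) ((∑' n, K n u) ^ 2) := by
    intro u hu
    have hnorm : Summable fun n => ‖K n u‖ :=
      hsum.of_nonneg_of_le (fun _ => norm_nonneg _) fun n => hle n u hu
    rw [sq, tsum_mul_tsum_eq_tsum_sum_range_of_summable_norm hnorm hnorm]
    exact (summable_norm_sum_mul_range_of_summable_norm hnorm hnorm).of_norm.hasSum
  have hcm (n : ℕ) : Measurable (c n) :=
    Finset.measurable_fun_sum _ fun i _ => (hKm i).mul (hKm (n - i))
  have hconv := (hasSum_mconv ρ hcm hcA hAsum hsquare ht).mul_left 2⁻¹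
  have hB2 : mconv (c 0) ρ t = mconv (fun u => B u ^ 2) ρ t :=
    mconv_congr ρ (fun u hu => by simp [hc, hK0 u hu, sq]) ht
  have htotal := (hconv.add (hasSum_ite_eq 0 (B t - 2⁻¹ * mconv (fun u => B u ^ 2) ρ t))).add
    (hasSum_ite_eq 1 (F t))
  have hterm (n : ℕ) : K n t = 2⁻¹ * mconv (c n) ρ t +
      (if n = 0 then B t - 2⁻¹ * mconv (fun u => B u ^ 2) ρ t else 0) +
      (if n = 1 then F t else 0) := by
    match n with
    | 0 => simp [hB2, hK0 t ht]
    | 1 =>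
      have hc1 : mconv (c 1) ρ t = 2 * mconv (fun u => K 0 u * K 1 u) ρ t := by
        rw [← mconv_const_mul]
        refine mconv_congr ρ (fun u _ => ?_) ht
        simp only [hc, Finset.sum_range_succ, Finset.sum_range_zero, Nat.sub_zero, Nat.sub_self]
        ring
      rw [hK1 t ht, hc1]
      simp
      ring
    | m + 2 =>
      rw [hKn (m + 2) (by omega) t ht, mconv_const_mul]
      simp [hc]
  rw [tsum_congr hterm, htotal.tsum_eq]
  ring
end
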